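/- arXiv:2310.11104 — 5 statements merged into one kernel-verified Lean document; each statement's English description precedes it below -/
import Mathlib

section
/- The inclusions Π_NN ⊆ Π_COP ⊆ Π* hold; that is, every matrix of the form Eᵀ(Q + J(J))E with J ∈ D^n and Q ∈ NN^{2n+1} lies in Π_COP, and every matrix of the form Eᵀ(Q + J(J))E with J ∈ D^n and Q ∈ COP^{2n+1} satisfies (1, q, Φ(q))ᵀ Π (1, q, Φ(q)) ≥ 0 for all q ∈ ℝ^n. -/
open Matrix

/-- The entrywise ReLU. -/
def reluVec {k : Type*} (q : k → ℝ) : k → ℝ := fun i => max (q i) 0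

/-- The vector `(1, q, p) ∈ ℝ^{2n+1}`. -/
def aug {n : ℕ} (q p : Fin n → ℝ) : Unit ⊕ Fin n ⊕ Fin n → ℝ :=
  Sum.elim (fun _ => 1) (Sum.elim q p)

/-- The multiplier class `Π⋆ ⊂ S^{2n+1}`. -/
def PiStar (n : ℕ) : Set (Matrix (Unit ⊕ Fin n ⊕ Fin n) (Unit ⊕ Fin n ⊕ Fin n) ℝ) :=
  {P | ∀ q p : Fin n → ℝ, p = reluVec q → 0 ≤ aug q p ⬝ᵥ P *ᵥ aug q p}

/-- The copositive cone `COP^k`: symmetric matrices whose quadratic form is nonnegative on the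
nonnegative orthant. -/
def COPcone (k : Type*) [Fintype k] : Set (Matrix k k ℝ) :=
  {Q | Q.IsSymm ∧ ∀ x : k → ℝ, (∀ i, 0 ≤ x i) → 0 ≤ x ⬝ᵥ Q *ᵥ x}

/-- The nonnegative cone `NN^k`: symmetric entrywise-nonnegative matrices. -/
def NNcone (k : Type*) [Fintype k] : Set (Matrix k k ℝ) :=
  {Q | Q.IsSymm ∧ ∀ i j, 0 ≤ Q i j}

/-- The matrix `E = [[1,0,0],[0,−Iₙ,Iₙ],[0,0,Iₙ]]`. -/
noncomputable def Emat (n : ℕ) :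
    Matrix (Unit ⊕ Fin n ⊕ Fin n) (Unit ⊕ Fin n ⊕ Fin n) ℝ :=
  Matrix.fromBlocks (1 : Matrix Unit Unit ℝ) 0 0
    (Matrix.fromBlocks (-(1 : Matrix (Fin n) (Fin n) ℝ)) (1 : Matrix (Fin n) (Fin n) ℝ)
      0 (1 : Matrix (Fin n) (Fin n) ℝ))

/-- The matrix `J(J) = [[0,0,0],[0,0,J],[0,Jᵀ,0]]` for `J ∈ D^n`. -/
def calJ {n : ℕ} (J : Matrix (Fin n) (Fin n) ℝ) :
    Matrix (Unit ⊕ Fin n ⊕ Fin n) (Unit ⊕ Fin n ⊕ Fin n) ℝ :=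
  Matrix.fromBlocks 0 0 0 (Matrix.fromBlocks 0 J Jᵀ 0)

/-- `Π_COP := {Eᵀ(Q + J(J))E : J ∈ D^n, Q ∈ COP^{2n+1}}`. -/
noncomputable def PiCOP (n : ℕ) :
    Set (Matrix (Unit ⊕ Fin n ⊕ Fin n) (Unit ⊕ Fin n ⊕ Fin n) ℝ) :=
  {P | ∃ (J : Matrix (Fin n) (Fin n) ℝ) (Q : Matrix (Unit ⊕ Fin n ⊕ Fin n) (Unit ⊕ Fin n ⊕ Fin n) ℝ),
    J.IsDiag ∧ Q ∈ COPcone _ ∧ P = (Emat n)ᵀ * (Q + calJ J) * Emat n}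

/-- `Π_NN := {Eᵀ(Q + J(J))E : J ∈ D^n, Q ∈ NN^{2n+1}}`. -/
noncomputable def PiNN (n : ℕ) :
    Set (Matrix (Unit ⊕ Fin n ⊕ Fin n) (Unit ⊕ Fin n ⊕ Fin n) ℝ) :=
  {P | ∃ (J : Matrix (Fin n) (Fin n) ℝ) (Q : Matrix (Unit ⊕ Fin n ⊕ Fin n) (Unit ⊕ Fin n ⊕ Fin n) ℝ),
    J.IsDiag ∧ Q ∈ NNcone _ ∧ P = (Emat n)ᵀ * (Q + calJ J) * Emat n}

theorem copositive_of_nonneg {k : Type*} [Fintype k] : NNcone k ⊆ COPcone k := by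
  rintro Q ⟨hsymm, hQ⟩
  exact ⟨hsymm, fun x hx => Finset.sum_nonneg fun i _ =>
    mul_nonneg (hx i) (Finset.sum_nonneg fun j _ => mul_nonneg (hQ i j) (hx j))⟩

theorem Emat_mulVec_aug {n : ℕ} (q p : Fin n → ℝ) : Emat n *ᵥ aug q p = aug (p - q) p := by
  ext (i | i | i) <;>
    simp [Emat, aug, Matrix.fromBlocks_mulVec, Function.comp_def, Matrix.neg_mulVec,
      sub_eq_neg_add]

theorem aug_dotProduct_calJ_mulVec_aug {n : ℕ} (J : Matrix (Fin n) (Fin n) ℝ) (u v : Fin n → ℝ) :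
    aug u v ⬝ᵥ calJ J *ᵥ aug u v = 2 * (u ⬝ᵥ J *ᵥ v) := by
  have h : v ⬝ᵥ Jᵀ *ᵥ u = u ⬝ᵥ J *ᵥ v := by
    rw [Matrix.mulVec_transpose, dotProduct_comm, Matrix.dotProduct_mulVec]
  simp [calJ, aug, Matrix.fromBlocks_mulVec, Function.comp_def, h, two_mul]

theorem relu_complementarity (t : ℝ) : (max t 0 - t) * max t 0 = 0 := by
  rcases le_total t 0 with h | h <;> simp [h]

theorem relu_dotProduct_diag_mulVec_eq_zero {n : ℕ} {J : Matrix (Fin n) (Fin n) ℝ}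
    (hJ : J.IsDiag) (q : Fin n → ℝ) : (reluVec q - q) ⬝ᵥ J *ᵥ reluVec q = 0 := by
  rw [← hJ.diagonal_diag]
  refine Finset.sum_eq_zero fun i _ => ?_
  rw [Matrix.mulVec_diagonal, mul_left_comm]
  exact mul_eq_zero_of_right _ (relu_complementarity (q i))

theorem aug_nonneg {n : ℕ} {u v : Fin n → ℝ} (hu : ∀ i, 0 ≤ u i) (hv : ∀ i, 0 ≤ v i) :
    ∀ i, 0 ≤ aug u v i := by
  rintro (i | i | i)
  exacts [zero_le_one, hu i, hv i]

/-- `Π_NN ⊆ Π_COP ⊆ Π⋆`. -/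
theorem PiNN_subset_PiCOP_subset_PiStar (n : ℕ) :
    PiNN n ⊆ PiCOP n ∧ PiCOP n ⊆ PiStar n := by
  constructor
  · rintro P ⟨J, Q, hJ, hQ, rfl⟩
    exact ⟨J, Q, hJ, copositive_of_nonneg hQ, rfl⟩
  · rintro P ⟨J, Q, hJ, hQ, rfl⟩ q p rfl
    rw [← Matrix.mulVec_mulVec, ← Matrix.mulVec_mulVec, Matrix.dotProduct_mulVec,
      Matrix.vecMul_transpose, Emat_mulVec_aug, Matrix.add_mulVec, dotProduct_add,
      aug_dotProduct_calJ_mulVec_aug, relu_dotProduct_diag_mulVec_eq_zero hJ, mul_zero, add_zero]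
    exact hQ.2 _ (aug_nonneg (fun i => sub_nonneg.2 (le_max_left _ _)) fun i => le_max_right _ _)
end

section
/- Let μ ≤ 0 ≤ ν and let φ : ℝ → ℝ satisfy φ(0) = 0 and, for all x ≠ y, μ ≤ (φ(x) − φ(y))/(x − y) ≤ s for some constant s < ν. Let Φ : ℝ^m → ℝ^m be the diagonal map Φ(x)_i = φ(x_i), and let M ∈ DHD^m. Then for every x ∈ ℝ^m, (−μ x + Φ(x))ᵀ M (ν x − Φ(x)) ≥ 0; equivalently, with u := ν x − Φ(x) and v := −μ x + Φ(x), the quadratic form (u, v)ᵀ [[0, Mᵀ], [M, 0]] (u, v) ≥ 0. -/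
open Matrix

/-- `M ∈ DHD^m`: doubly hyperdominant matrices (off-diagonal entries nonpositive,
nonnegative row sums and nonnegative column sums). -/
def DHD {m : ℕ} (M : Matrix (Fin m) (Fin m) ℝ) : Prop :=
  (∀ i j, i ≠ j → M i j ≤ 0) ∧ (∀ i, 0 ≤ ∑ j, M i j) ∧ (∀ j, 0 ≤ ∑ i, M i j)

/-- The supporting-line inequality for the primitive of a monotone function. -/
theorem Monotone.mul_sub_le_integral {f : ℝ → ℝ} (hf : Monotone f) (a b : ℝ) :
    f a * (b - a) ≤ ∫ t in a..b, f t := by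
  rcases le_total a b with hab | hba
  · have h := intervalIntegral.integral_mono_on hab
      (intervalIntegrable_const (μ := MeasureTheory.volume) (c := f a)) hf.intervalIntegrable (fun t ht => hf ht.1)
    rw [intervalIntegral.integral_const, smul_eq_mul] at h
    linarith
  · have h := intervalIntegral.integral_mono_on hba
      hf.intervalIntegrable (intervalIntegrable_const (μ := MeasureTheory.volume) (c := f a)) (fun t ht => hf ht.2)
    rw [intervalIntegral.integral_const, smul_eq_mul] at h
    rw [intervalIntegral.integral_symm]
    linarith

/-- A doubly hyperdominant bilinear form is nonnegative on pairs `(v, u)` for which `v` is a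
selection of subgradients, at the points `u`, of a nonnegative function vanishing at zero,
with values `F`. -/
theorem DHD.dotProduct_mulVec_nonneg {m : ℕ} {M : Matrix (Fin m) (Fin m) ℝ} (hM : DHD M)
    {u v F : Fin m → ℝ} (hF : ∀ i, 0 ≤ F i) (hFle : ∀ i, F i ≤ v i * u i)
    (hsub : ∀ i j, v i * (u j - u i) ≤ F j - F i) : 0 ≤ v ⬝ᵥ M *ᵥ u := by
  obtain ⟨hoff, hrow, hcol⟩ := hM
  have hentry : ∀ i j, M i j * (F j - F i) ≤ M i j * (v i * (u j - u i)) := by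
    intro i j
    rcases eq_or_ne i j with rfl | hij
    · simp
    · exact mul_le_mul_of_nonpos_left (hsub i j) (hoff i j hij)
  calc
    0 ≤ ∑ j, (∑ i, M i j) * F j :=
      Finset.sum_nonneg fun j _ => mul_nonneg (hcol j) (hF j)
    _ = ∑ i, ((∑ j, M i j) * F i + ∑ j, M i j * (F j - F i)) := by
      simp only [Finset.sum_mul]
      rw [Finset.sum_comm]
      refine Finset.sum_congr rfl fun i _ => ?_
      rw [← Finset.sum_add_distrib]
      exact Finset.sum_congr rfl fun j _ => by ring
    _ ≤ ∑ i, ((∑ j, M i j) * (v i * u i) + ∑ j, M i j * (v i * (u j - u i))) := by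
      refine Finset.sum_le_sum fun i _ => add_le_add ?_ ?_
      · exact mul_le_mul_of_nonneg_left (hFle i) (hrow i)
      · exact Finset.sum_le_sum fun j _ => hentry i j
    _ = v ⬝ᵥ M *ᵥ u := by
      simp only [dotProduct, mulVec, Finset.mul_sum, Finset.sum_mul]
      refine Finset.sum_congr rfl fun i _ => ?_
      rw [← Finset.sum_add_distrib]
      exact Finset.sum_congr rfl fun j _ => by ring

/-- A doubly hyperdominant bilinear form is nonnegative on pairs `(v, u)` with `v = f ∘ u` for
a monotone `f` vanishing at zero. -/
theorem DHD.dotProduct_mulVec_nonneg_of_monotone {m : ℕ} {M : Matrix (Fin m) (Fin m) ℝ}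
    (hM : DHD M) {f : ℝ → ℝ} (hf : Monotone f) (hf0 : f 0 = 0) (u : Fin m → ℝ) :
    0 ≤ (fun i => f (u i)) ⬝ᵥ M *ᵥ u := by
  refine hM.dotProduct_mulVec_nonneg (F := fun i => ∫ t in 0..u i, f t)
    (fun i => ?_) (fun i => ?_) (fun i j => ?_)
  · simpa [hf0] using hf.mul_sub_le_integral 0 (u i)
  · have h := hf.mul_sub_le_integral (u i) 0
    rw [intervalIntegral.integral_symm] at h
    linarith
  · rw [intervalIntegral.integral_interval_sub_left hf.intervalIntegrable hf.intervalIntegrable]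
    exact hf.mul_sub_le_integral (u i) (u j)

/-- On a finite set, a monotone function factors through a strictly monotone one via a function
that is monotone everywhere. -/
theorem Monotone.exists_monotone_factor {v u : ℝ → ℝ} (hv : Monotone v) (hu : StrictMono u)
    {s : Set ℝ} (hs : s.Finite) : ∃ f : ℝ → ℝ, Monotone f ∧ ∀ x ∈ s, f (u x) = v x := by
  have hinv : ∀ x, v (Function.invFun u (u x)) = v x := fun x =>
    congrArg v (Function.leftInverse_invFun hu.injective x)
  have hmono : MonotoneOn (v ∘ Function.invFun u) (u '' s) := by
    rintro _ ⟨x, -, rfl⟩ _ ⟨y, -, rfl⟩ hxy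
    simpa only [Function.comp_apply, hinv] using hv (hu.le_iff_le.1 hxy)
  have hfin : ((v ∘ Function.invFun u) '' (u '' s)).Finite := (hs.image _).image _
  obtain ⟨f, hf, heq⟩ := hmono.exists_monotone_extension hfin.bddBelow hfin.bddAbove
  exact ⟨f, hf, fun x hx => (heq (Set.mem_image_of_mem u hx)).symm.trans (hinv x)⟩

/-- **O'Shea-Zames-Falb.** Let `μ ≤ 0 ≤ ν`, let `φ : ℝ → ℝ` satisfy `φ(0) = 0`
and be slope-restricted: for all `x ≠ y`, `μ ≤ (φ(x) − φ(y))/(x − y) ≤ s` for some `s < ν`.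
Let `Φ` act diagonally and `M ∈ DHD^m`.  Then for every `x ∈ ℝ^m`,
`(−μ x + Φ(x))ᵀ M (ν x − Φ(x)) ≥ 0`. -/
theorem OZF_multiplier {m : ℕ} (μ ν s : ℝ) (hμ : μ ≤ 0) (hν : 0 ≤ ν) (hs : s < ν)
    (φ : ℝ → ℝ) (hφ0 : φ 0 = 0)
    (hslope : ∀ x y : ℝ, x ≠ y →
      μ ≤ (φ x - φ y) / (x - y) ∧ (φ x - φ y) / (x - y) ≤ s)
    (M : Matrix (Fin m) (Fin m) ℝ) (hM : DHD M) (x : Fin m → ℝ) :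
    0 ≤ (fun i => -μ * x i + φ (x i)) ⬝ᵥ M *ᵥ (fun i => ν * x i - φ (x i)) := by
  have hv : Monotone fun t => -μ * t + φ t := by
    refine monotone_iff_forall_lt.2 fun a b hab => ?_
    have h := (le_div_iff₀ (sub_pos.2 hab)).1 (hslope b a hab.ne').1
    linarith
  have hu : StrictMono fun t => ν * t - φ t := by
    intro a b hab
    have h := (div_le_iff₀ (sub_pos.2 hab)).1 (hslope b a hab.ne').2
    have h' := mul_lt_mul_of_pos_right hs (sub_pos.2 hab)
    simp only
    linarith
  obtain ⟨f, hf, hfu⟩ := hv.exists_monotone_factor hu ((Set.finite_range x).insert 0)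
  have hf0 : f 0 = 0 := by simpa [hφ0] using hfu 0 (Set.mem_insert _ _)
  have hfx : (fun i => -μ * x i + φ (x i)) = fun i => f (ν * x i - φ (x i)) :=
    funext fun i => (hfu (x i) (Set.mem_insert_of_mem _ ⟨i, rfl⟩)).symm
  rw [hfx]
  exact hM.dotProduct_mulVec_nonneg_of_monotone hf hf0 _
end

section
/- The inclusion Π_Faz ⊆ Π* holds; that is, every Π ∈ S^{2n+1} of the block form Π = [[0, −νᵀ, (ν+η)ᵀ], [−ν, 0, Λ+T], [ν+η, (Λ+T)ᵀ, −2(Λ+T)]] with ν, η ∈ ℝ^n entrywise nonnegative, Λ ∈ D^n, and T ∈ T^n satisfies (1, q, Φ(q))ᵀ Π (1, q, Φ(q)) ≥ 0 for all q ∈ ℝ^n. -/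
open Matrix

/-- `T^n := {Σ_{i<j} λᵢⱼ (eᵢ−eⱼ)(eᵢ−eⱼ)ᵀ : λᵢⱼ ≥ 0}`. -/
def Tcone (n : ℕ) : Set (Matrix (Fin n) (Fin n) ℝ) :=
  {T | ∃ lam : Fin n → Fin n → ℝ, (∀ i j, 0 ≤ lam i j) ∧
    T = ∑ p ∈ Finset.univ.filter (fun p : Fin n × Fin n => p.1 < p.2),
      lam p.1 p.2 • Matrix.vecMulVec (Pi.single p.1 1 - Pi.single p.2 1)
        (Pi.single p.1 1 - Pi.single p.2 1)}

/-- The multiplier class of Fazlyab et al.: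
`Π_Faz := { [[0, −νᵀ, (ν+η)ᵀ], [−ν, 0, Λ+T], [ν+η, (Λ+T)ᵀ, −2(Λ+T)]] :
ν, η ≥ 0, Λ ∈ D^n, T ∈ T^n }`. -/
def PiFaz (n : ℕ) :
    Set (Matrix (Unit ⊕ Fin n ⊕ Fin n) (Unit ⊕ Fin n ⊕ Fin n) ℝ) :=
  {P | ∃ (ν η : Fin n → ℝ) (Λ T : Matrix (Fin n) (Fin n) ℝ),
    (∀ i, 0 ≤ ν i) ∧ (∀ i, 0 ≤ η i) ∧ Λ.IsDiag ∧ T ∈ Tcone n ∧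
    P = Matrix.fromBlocks (0 : Matrix Unit Unit ℝ)
      (Matrix.of fun (_ : Unit) j => Sum.elim (fun k => -ν k) (fun k => ν k + η k) j)
      (Matrix.of fun i (_ : Unit) => Sum.elim (fun k => -ν k) (fun k => ν k + η k) i)
      (Matrix.fromBlocks 0 (Λ + T) (Λ + T)ᵀ (-(2 : ℝ) • (Λ + T)))}

theorem le_reluVec {k : Type*} (q : k → ℝ) (i : k) : q i ≤ reluVec q i := le_max_left _ _

theorem reluVec_nonneg {k : Type*} (q : k → ℝ) (i : k) : 0 ≤ reluVec q i := le_max_right _ _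

/-- Complementarity of `q - Φ(q)` and `Φ(q)`. -/
theorem sub_reluVec_mul_reluVec {k : Type*} (q : k → ℝ) (i : k) :
    (q i - reluVec q i) * reluVec q i = 0 := by
  unfold reluVec
  rcases le_total (q i) 0 with h | h <;> simp [h]

theorem dotProduct_isDiag_mulVec_reluVec {n : ℕ} {Λ : Matrix (Fin n) (Fin n) ℝ} (hΛ : Λ.IsDiag)
    (q : Fin n → ℝ) : (q - reluVec q) ⬝ᵥ Λ *ᵥ reluVec q = 0 := by
  rw [← hΛ.diagonal_diag]
  refine Finset.sum_eq_zero fun i _ => ?_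
  rw [mulVec_diagonal, Pi.sub_apply]
  linear_combination Λ.diag i * sub_reluVec_mul_reluVec q i

theorem dotProduct_Tcone_mulVec_reluVec_nonneg {n : ℕ} {T : Matrix (Fin n) (Fin n) ℝ}
    (hT : T ∈ Tcone n) (q : Fin n → ℝ) : 0 ≤ (q - reluVec q) ⬝ᵥ T *ᵥ reluVec q := by
  obtain ⟨lam, hlam, rfl⟩ := hT
  rw [sum_mulVec, dotProduct_sum]
  refine Finset.sum_nonneg fun ⟨i, j⟩ _ => ?_
  rw [smul_mulVec, dotProduct_smul, vecMulVec_mulVec, op_smul_eq_smul, dotProduct_smul]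
  refine mul_nonneg (hlam i j) ?_
  simp only [sub_dotProduct, dotProduct_sub, single_one_dotProduct, dotProduct_single_one,
    Pi.sub_apply, smul_eq_mul]
  nlinarith [sub_reluVec_mul_reluVec q i, sub_reluVec_mul_reluVec q j,
    mul_nonneg (sub_nonneg.2 (le_reluVec q i)) (reluVec_nonneg q j),
    mul_nonneg (sub_nonneg.2 (le_reluVec q j)) (reluVec_nonneg q i)]

/-- The quadratic form of a block multiplier with off-diagonal blocks `-ν`, `ν + η` and `M`. -/
theorem aug_dotProduct_fromBlocks_mulVec {n : ℕ} (ν η q p : Fin n → ℝ)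
    (M : Matrix (Fin n) (Fin n) ℝ) :
    aug q p ⬝ᵥ Matrix.fromBlocks (0 : Matrix Unit Unit ℝ)
      (Matrix.of fun (_ : Unit) j => Sum.elim (fun k => -ν k) (fun k => ν k + η k) j)
      (Matrix.of fun i (_ : Unit) => Sum.elim (fun k => -ν k) (fun k => ν k + η k) i)
      (Matrix.fromBlocks 0 M Mᵀ (-(2 : ℝ) • M)) *ᵥ aug q p =
    2 * (ν ⬝ᵥ (p - q) + η ⬝ᵥ p + (q - p) ⬝ᵥ M *ᵥ p) := by
  have hT : p ⬝ᵥ Mᵀ *ᵥ q = q ⬝ᵥ M *ᵥ p := by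
    rw [mulVec_transpose, dotProduct_comm, dotProduct_mulVec]
  have hrow : (Matrix.of fun (_ : Unit) j =>
      Sum.elim (fun k => -ν k) (fun k => ν k + η k) j) *ᵥ Sum.elim q p =
      fun _ => ν ⬝ᵥ (p - q) + η ⬝ᵥ p := by
    ext
    change Sum.elim (-ν) (ν + η) ⬝ᵥ Sum.elim q p = _
    rw [sumElim_dotProduct_sumElim, neg_dotProduct, add_dotProduct, dotProduct_sub]
    ring
  have hcol : (Matrix.of fun i (_ : Unit) =>
      Sum.elim (fun k => -ν k) (fun k => ν k + η k) i) *ᵥ (fun _ => (1 : ℝ)) =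
      Sum.elim (-ν) (ν + η) := by
    ext i
    rcases i with i | i <;> simp [mulVec, dotProduct]
  unfold aug
  rw [fromBlocks_mulVec, Sum.elim_comp_inl, Sum.elim_comp_inr, hrow, hcol, fromBlocks_mulVec,
    Sum.elim_comp_inl, Sum.elim_comp_inr, sumElim_dotProduct_sumElim, dotProduct_add,
    dotProduct_add, sumElim_dotProduct_sumElim, sumElim_dotProduct_sumElim]
  simp only [zero_mulVec, dotProduct_zero, zero_add, dotProduct_add, smul_mulVec,
    dotProduct_smul, hT, sub_dotProduct, dotProduct_sub, dotProduct_neg, smul_eq_mul,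
    dotProduct_comm q ν, dotProduct_comm p ν, dotProduct_comm p η]
  simp only [dotProduct, Finset.univ_unique, Finset.sum_singleton]
  ring

/-- `Π_Faz ⊆ Π⋆`. -/
theorem PiFaz_subset_PiStar (n : ℕ) : PiFaz n ⊆ PiStar n := by
  rintro _ ⟨ν, η, Λ, T, hν, hη, hΛ, hT, rfl⟩ q _ rfl
  rw [aug_dotProduct_fromBlocks_mulVec, add_mulVec, dotProduct_add,
    dotProduct_isDiag_mulVec_reluVec hΛ]
  have h₁ : 0 ≤ ν ⬝ᵥ (reluVec q - q) :=
    dotProduct_nonneg_of_nonneg hν fun i => sub_nonneg.2 (le_reluVec q i)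
  have h₂ : 0 ≤ η ⬝ᵥ reluVec q := dotProduct_nonneg_of_nonneg hη (reluVec_nonneg q)
  have h₃ := dotProduct_Tcone_mulVec_reluVec_nonneg hT q
  linarith
end

section
/- The inclusion Π_Faz ⊆ Π_NN holds; that is, for all ν, η ∈ ℝ^n entrywise nonnegative, Λ ∈ D^n, and T ∈ T^n, there exist J ∈ D^n and Q ∈ NN^{2n+1} such that [[0, −νᵀ, (ν+η)ᵀ], [−ν, 0, Λ+T], [ν+η, (Λ+T)ᵀ, −2(Λ+T)]] = Eᵀ(Q + J(J))E. -/
open Matrix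

/-- Matrices in `T^n` are symmetric. -/
theorem isSymm_of_mem_Tcone {n : ℕ} {T : Matrix (Fin n) (Fin n) ℝ} (hT : T ∈ Tcone n) :
    T.IsSymm := by
  obtain ⟨lam, -, rfl⟩ := hT
  ext i j
  simp only [transpose_apply, Matrix.sum_apply, Matrix.smul_apply, vecMulVec_apply]
  exact Finset.sum_congr rfl fun p _ => by rw [mul_comm]

/-- Off-diagonal entries of matrices in `T^n` are nonpositive. -/
theorem apply_nonpos_of_mem_Tcone {n : ℕ} {T : Matrix (Fin n) (Fin n) ℝ} (hT : T ∈ Tcone n)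
    {i j : Fin n} (hij : i ≠ j) : T i j ≤ 0 := by
  obtain ⟨lam, hlam, rfl⟩ := hT
  simp only [Matrix.sum_apply, Matrix.smul_apply, vecMulVec_apply, smul_eq_mul]
  refine Finset.sum_nonpos fun p _ => mul_nonpos_of_nonneg_of_nonpos (hlam _ _) ?_
  simp only [Pi.sub_apply, Pi.single_apply]
  split_ifs <;> simp_all

/-- `Π_Faz ⊆ Π_NN`: for all entrywise-nonnegative `ν, η ∈ ℝ^n`, diagonal `Λ` and
`T ∈ T^n`, there exist a diagonal `J` and `Q ∈ NN^{2n+1}` such that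
`[[0, −νᵀ, (ν+η)ᵀ], [−ν, 0, Λ+T], [ν+η, (Λ+T)ᵀ, −2(Λ+T)]] = Eᵀ(Q + J(J))E`. -/
theorem PiFaz_subset_PiNN {n : ℕ} (ν η : Fin n → ℝ)
    (hν : ∀ i, 0 ≤ ν i) (hη : ∀ i, 0 ≤ η i)
    (Λ T : Matrix (Fin n) (Fin n) ℝ) (hΛ : Λ.IsDiag) (hT : T ∈ Tcone n) :
    ∃ (J : Matrix (Fin n) (Fin n) ℝ)
      (Q : Matrix (Unit ⊕ Fin n ⊕ Fin n) (Unit ⊕ Fin n ⊕ Fin n) ℝ),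
      J.IsDiag ∧ Q ∈ NNcone _ ∧
      Matrix.fromBlocks (0 : Matrix Unit Unit ℝ)
          (Matrix.of fun (_ : Unit) j => Sum.elim (fun k => -ν k) (fun k => ν k + η k) j)
          (Matrix.of fun i (_ : Unit) => Sum.elim (fun k => -ν k) (fun k => ν k + η k) i)
          (Matrix.fromBlocks 0 (Λ + T) (Λ + T)ᵀ (-(2 : ℝ) • (Λ + T))) =
        (Emat n)ᵀ * (Q + calJ J) * Emat n := by
  have hS : (Λ + T)ᵀ = Λ + T := by
    rw [transpose_add, hΛ.isSymm.eq, (isSymm_of_mem_Tcone hT).eq]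
  set S := Λ + T with hS_def
  have hS_off : ∀ i j, i ≠ j → S i j ≤ 0 := fun i j hij => by
    simpa [hS_def, hΛ hij] using apply_nonpos_of_mem_Tcone hT hij
  set J : Matrix (Fin n) (Fin n) ℝ := diagonal fun i => -S i i with hJ_def
  have hJ : Jᵀ = J := diagonal_transpose _
  have hN : ∀ i j, 0 ≤ (-S - J) i j := fun i j => by
    rcases eq_or_ne i j with rfl | hij
    · simp [hJ_def]
    · simpa [hJ_def, hij] using hS_off i j hij
  have hN_symm : (-S - J)ᵀ = -S - J := by
    rw [transpose_sub, transpose_neg, hS, hJ]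
  let r : Matrix Unit (Fin n ⊕ Fin n) ℝ := of fun _ => Sum.elim ν η
  refine ⟨J, fromBlocks 0 r rᵀ (fromBlocks 0 (-S - J) (-S - J) 0),
    isDiag_diagonal _, ⟨?_, ?_⟩, ?_⟩
  · simp [IsSymm, fromBlocks_transpose, hN_symm]
  · rintro (i | i | i) (j | j | j) <;>
      first
      | exact le_rfl
      | exact hN i j
      | exact hν _
      | exact hη _
  · simp only [Emat, calJ, fromBlocks_transpose, fromBlocks_add, fromBlocks_multiply, hS, hJ,
      transpose_one, transpose_zero, transpose_neg]
    congr 1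
    · simp
    · ext u (j | j) <;> simp [r, Matrix.mul_apply, fromBlocks, Matrix.one_apply]
    · ext (i | i) u <;> simp [r, Matrix.mul_apply, fromBlocks, Matrix.one_apply]
    · simp [fromBlocks_multiply, two_smul, sub_eq_add_neg]
end

section
/- Let q ∈ ℝ^n and p := Φ(q), where Φ is the entrywise ReLU. Then for all indices i ≠ j, ((p_i − q_i) − (p_j − q_j)) · (p_i − p_j) ≤ 0. Consequently, for every T ∈ T^n one has (p − q)ᵀ T p ≤ 0. -/
open Matrix

theorem reluVec_sub_mul_nonpos {k : Type*} (q : k → ℝ) (i j : k) :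
    ((reluVec q i - q i) - (reluVec q j - q j)) * (reluVec q i - reluVec q j) ≤ 0 := by
  unfold reluVec
  rcases le_total (q i) 0 with hi | hi <;> rcases le_total (q j) 0 with hj | hj <;>
    simp only [max_eq_left, max_eq_right, hi, hj] <;> nlinarith

theorem dotProduct_vecMulVec_single_sub_single_mulVec {k : Type*} [Fintype k] [DecidableEq k]
    (v w : k → ℝ) (i j : k) :
    v ⬝ᵥ vecMulVec (Pi.single i 1 - Pi.single j 1) (Pi.single i 1 - Pi.single j 1) *ᵥ w =
      (v i - v j) * (w i - w j) := by
  rw [dotProduct_mulVec, vecMul_vecMulVec, smul_dotProduct, dotProduct_sub, sub_dotProduct]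
  simp

/-- For `p = Φ(q)`: for all `i ≠ j`,
`((pᵢ − qᵢ) − (pⱼ − qⱼ))(pᵢ − pⱼ) ≤ 0`, and consequently `(p − q)ᵀ T p ≤ 0` for every
`T ∈ T^n`. -/
theorem relu_Tcone_inequality {n : ℕ} (q p : Fin n → ℝ) (hp : p = reluVec q) :
    (∀ i j : Fin n, i ≠ j →
      ((p i - q i) - (p j - q j)) * (p i - p j) ≤ 0) ∧
    ∀ T ∈ Tcone n, (p - q) ⬝ᵥ T *ᵥ p ≤ 0 := by
  subst hp
  refine ⟨fun i j _ => reluVec_sub_mul_nonpos q i j, ?_⟩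
  rintro T ⟨lam, hlam, rfl⟩
  rw [sum_mulVec, dotProduct_sum]
  refine Finset.sum_nonpos fun x _ => ?_
  rw [smul_mulVec, dotProduct_smul, dotProduct_vecMulVec_single_sub_single_mulVec]
  exact smul_nonpos_of_nonneg_of_nonpos (hlam _ _) (reluVec_sub_mul_nonpos q x.1 x.2)
end
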